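/- arXiv:2506.18215 — 2 statements merged into one kernel-verified Lean document; each statement's English description precedes it below -/
import Mathlib

section
/- Let e be a random variable taking values in (0,1) whose law satisfies regular variation at 0 with index γ₁−1 for some γ₁>1, let h_n := inf{ w>0 : w⁻¹·P(e ≤ w⁻¹) ≤ 1/n }, and let (b_n) be a nonnegative sequence with h_n b_n → θ for some θ ∈ [0,∞). Then n·h_n⁻¹·P(e ≤ b_n) → θ^{γ₁−1} and n·b_n·P(e ≤ b_n) → θ^{γ₁} as n→∞. -/
open MeasureTheory Filter Set Topology
open scoped ENNReal Topology

/-- If a monotone function `F` is regularly varying at `0` with index `p > 0`, then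
`F (t * u) / F t → θ ^ p` along `t → 0⁺`, `u → θ`. -/
theorem Monotone.tendsto_div_of_regularlyVarying {ι : Type*} {l : Filter ι} {F : ℝ → ℝ}
    (hF : Monotone F) (hF0 : ∀ x, 0 ≤ F x) {p : ℝ} (hp : 0 < p)
    (hRV : ∀ x : ℝ, 0 < x → Tendsto (fun t => F (t * x) / F t) (𝓝[>] 0) (𝓝 (x ^ p)))
    {t u : ι → ℝ} (ht : Tendsto t l (𝓝[>] 0)) {θ : ℝ} (hθ : 0 ≤ θ) (hu : Tendsto u l (𝓝 θ)) :
    Tendsto (fun i => F (t i * u i) / F (t i)) l (𝓝 (θ ^ p)) := by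
  have hpow : ContinuousAt (fun x : ℝ => x ^ p) θ := Real.continuousAt_rpow_const θ p (Or.inr hp.le)
  have ht0 : ∀ᶠ i in l, 0 < t i := ht.eventually self_mem_nhdsWithin
  refine tendsto_order.2 ⟨fun a ha => ?_, fun a ha => ?_⟩
  · rcases hθ.eq_or_lt with rfl | hθ
    · rw [Real.zero_rpow hp.ne'] at ha
      exact Eventually.of_forall fun i => ha.trans_le (div_nonneg (hF0 _) (hF0 _))
    · obtain ⟨x, hxa, hx0, hxθ⟩ :=
        (((hpow.eventually (lt_mem_nhds ha)).filter_mono nhdsWithin_le_nhds).and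
          (Ioo_mem_nhdsLT hθ)).exists
      filter_upwards [((hRV x hx0).comp ht).eventually (lt_mem_nhds hxa), ht0,
        hu.eventually (lt_mem_nhds hxθ)] with i hi hti hui
      exact hi.trans_le (div_le_div_of_nonneg_right
        (hF (mul_le_mul_of_nonneg_left hui.le hti.le)) (hF0 _))
  · obtain ⟨x, hxa, hxθ⟩ :=
      (((hpow.eventually (gt_mem_nhds ha)).filter_mono nhdsWithin_le_nhds).and
        (self_mem_nhdsWithin : Ioi θ ∈ 𝓝[>] θ)).exists
    filter_upwards [((hRV x (hθ.trans_lt hxθ)).comp ht).eventually (gt_mem_nhds hxa), ht0,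
      hu.eventually (gt_mem_nhds hxθ)] with i hi hti hui
    exact (div_le_div_of_nonneg_right
      (hF (mul_le_mul_of_nonneg_left hui.le hti.le)) (hF0 _)).trans_lt hi

/-- If `F` is regularly varying at `0`, and `t → 0⁺` is such that `n * s * F s` crosses the level
`1` at `s = t n`, then `n * t n * F (t n) → 1`. -/
theorem tendsto_mul_one_of_regularlyVarying {F : ℝ → ℝ} (hF0 : ∀ x, 0 < x → 0 < F x) {p : ℝ}
    (hRV : ∀ x : ℝ, 0 < x → Tendsto (fun t => F (t * x) / F t) (𝓝[>] 0) (𝓝 (x ^ p)))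
    {t : ℕ → ℝ} (ht : Tendsto t atTop (𝓝[>] 0))
    (hle : ∀ x, 0 < x → x < 1 → ∀ᶠ n : ℕ in atTop, n * (t n * x) * F (t n * x) ≤ 1)
    (hge : ∀ x, 1 < x → ∀ᶠ n : ℕ in atTop, 1 ≤ n * (t n * x) * F (t n * x)) :
    Tendsto (fun n : ℕ => n * t n * F (t n)) atTop (𝓝 1) := by
  have ht0 : ∀ᶠ n in atTop, 0 < t n := ht.eventually self_mem_nhdsWithin
  have hpow (a : ℝ) : Tendsto (fun x : ℝ => a * (x * x ^ p)) (𝓝 1) (𝓝 a) := by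
    have h : ContinuousAt (fun x : ℝ => a * (x * x ^ p)) 1 :=
      continuousAt_const.mul (continuousAt_id.mul
        (Real.continuousAt_rpow_const 1 p (Or.inl one_ne_zero)))
    simpa [ContinuousAt] using h
  have hlim (a x : ℝ) (hx : 0 < x) :
      Tendsto (fun n => a * (x * (F (t n * x) / F (t n)))) atTop (𝓝 (a * (x * x ^ p))) :=
    (((hRV x hx).comp ht).const_mul x).const_mul a
  have hfactor (n : ℕ) (x : ℝ) (hn : 0 < t n) :
      n * (t n * x) * F (t n * x) = n * t n * F (t n) * (x * (F (t n * x) / F (t n))) := by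
    have := (hF0 _ hn).ne'
    field_simp
  refine tendsto_order.2 ⟨fun a ha => ?_, fun a ha => ?_⟩
  · obtain ⟨x, hxa, hx⟩ := ((((hpow a).eventually (gt_mem_nhds ha)).filter_mono
      nhdsWithin_le_nhds).and (self_mem_nhdsWithin : Ioi (1 : ℝ) ∈ 𝓝[>] 1)).exists
    have hx0 : 0 < x := one_pos.trans hx
    filter_upwards [(hlim a x hx0).eventually (gt_mem_nhds hxa), ht0, hge x hx] with n hn htn h1
    rw [hfactor n x htn] at h1
    have := hF0 _ htn
    have := hF0 _ (mul_pos htn hx0)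
    exact lt_of_mul_lt_mul_right (hn.trans_le h1) (by positivity)
  · obtain ⟨x, hxa, hx0, hx⟩ := ((((hpow a).eventually (lt_mem_nhds ha)).filter_mono
      nhdsWithin_le_nhds).and (Ioo_mem_nhdsLT one_pos)).exists
    filter_upwards [(hlim a x hx0).eventually (lt_mem_nhds hxa), ht0, hle x hx0 hx] with n hn htn h1
    rw [hfactor n x htn] at h1
    have := hF0 _ htn
    have := hF0 _ (mul_pos htn hx0)
    exact lt_of_mul_lt_mul_right (h1.trans_lt hn) (by positivity)

/-- The generalized inverse at level `1 / n` of the positive function `w ↦ w⁻¹ * F w⁻¹` tends to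
infinity. -/
theorem tendsto_sInf_inv_mul_atTop {F : ℝ → ℝ} (hF : Monotone F)
    (hF0 : ∀ x, 0 < x → 0 < F x) (hF1 : ∀ x, F x ≤ 1) :
    Tendsto (fun n : ℕ => sInf {w : ℝ | 0 < w ∧ w⁻¹ * F w⁻¹ ≤ 1 / (n : ℝ)}) atTop atTop := by
  refine tendsto_atTop.2 fun M => ?_
  set K := max M 1
  have hK : 0 < K := one_pos.trans_le (le_max_right _ _)
  have hG : 0 < K⁻¹ * F K⁻¹ := mul_pos (inv_pos.2 hK) (hF0 _ (inv_pos.2 hK))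
  filter_upwards [tendsto_one_div_atTop_nhds_zero_nat.eventually (gt_mem_nhds hG),
    eventually_gt_atTop 0] with n hn hn0
  have hn' : (0 : ℝ) < n := Nat.cast_pos.2 hn0
  refine (le_max_left M 1).trans (le_csInf ⟨n, hn', ?_⟩ fun w hw => ?_)
  · rw [one_div]
    exact mul_le_of_le_one_right (inv_nonneg.2 hn'.le) (hF1 _)
  · by_contra! hlt
    have hinv : K⁻¹ ≤ w⁻¹ := inv_anti₀ hw.1 hlt.le
    have := mul_le_mul hinv (hF hinv) (hF0 _ (inv_pos.2 hK)).le (inv_nonneg.2 hw.1.le)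
    linarith [hw.2]

/-- Let the law `μ` of a `(0,1)`-valued random variable `e` be regularly varying
at `0` with index `γ₁ - 1` (for some `γ₁ > 1`), let
`h_n := inf { w > 0 : w⁻¹ · P(e ≤ w⁻¹) ≤ 1/n }`, and let `(b_n)` be a nonnegative sequence with
`h_n b_n → θ ∈ [0,∞)`.  Then `n · h_n⁻¹ · P(e ≤ b_n) → θ^{γ₁-1}` and
`n · b_n · P(e ≤ b_n) → θ^{γ₁}` as `n → ∞`. -/
theorem truncation_level_key_limits
    (μ : Measure ℝ) [IsProbabilityMeasure μ]
    (hsupp : μ (Set.Ioo (0:ℝ) 1) = 1)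
    (γ₁ : ℝ) (hγ : 1 < γ₁)
    (hpos : ∀ t : ℝ, 0 < t → μ (Set.Iic t) ≠ 0)
    (hRV : ∀ x : ℝ, 0 < x →
      Tendsto (fun t : ℝ => (μ (Set.Iic (t * x))).toReal / (μ (Set.Iic t)).toReal)
        (𝓝[>] 0) (𝓝 (x ^ (γ₁ - 1))))
    (h : ℕ → ℝ)
    (hh : ∀ n : ℕ, h n =
      sInf {w : ℝ | 0 < w ∧ w⁻¹ * (μ (Set.Iic w⁻¹)).toReal ≤ 1 / (n : ℝ)})
    (b : ℕ → ℝ) (hb : ∀ n, 0 ≤ b n)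
    (θ : ℝ) (hθ : 0 ≤ θ)
    (hbθ : Tendsto (fun n : ℕ => h n * b n) atTop (𝓝 θ)) :
    Tendsto (fun n : ℕ => (n : ℝ) * (h n)⁻¹ * (μ (Set.Iic (b n))).toReal)
        atTop (𝓝 (θ ^ (γ₁ - 1)))
    ∧ Tendsto (fun n : ℕ => (n : ℝ) * b n * (μ (Set.Iic (b n))).toReal)
        atTop (𝓝 (θ ^ γ₁)) := by
  obtain ⟨F, hFμ⟩ : ∃ F : ℝ → ℝ, ∀ t, F t = (μ (Set.Iic t)).toReal := ⟨_, fun _ => rfl⟩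
  have hF : Monotone F := fun x y hxy => by
    rw [hFμ, hFμ]
    exact ENNReal.toReal_mono (measure_ne_top _ _) (measure_mono (Iic_subset_Iic.2 hxy))
  have hF0 (x : ℝ) (hx : 0 < x) : 0 < F x := by
    rw [hFμ]
    exact ENNReal.toReal_pos (hpos x hx) (measure_ne_top _ _)
  have hF_nonneg (x : ℝ) : 0 ≤ F x := by
    rw [hFμ]
    exact ENNReal.toReal_nonneg
  have hF1 (x : ℝ) : F x ≤ 1 := by
    rw [hFμ]
    exact measureReal_le_one
  simp only [← hFμ] at hRV hh ⊢
  have hne (n : ℕ) (hn : (0 : ℝ) < n) : {w : ℝ | 0 < w ∧ w⁻¹ * F w⁻¹ ≤ 1 / (n : ℝ)}.Nonempty := by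
    refine ⟨n, hn, ?_⟩
    rw [one_div]
    exact mul_le_of_le_one_right (inv_nonneg.2 hn.le) (hF1 _)
  have hinf : Tendsto h atTop atTop := by
    rw [funext hh]
    exact tendsto_sInf_inv_mul_atTop hF hF0 hF1
  have ht : Tendsto (fun n => (h n)⁻¹) atTop (𝓝[>] 0) := tendsto_inv_atTop_nhdsGT_zero.comp hinf
  have hcross : Tendsto (fun n : ℕ => n * (h n)⁻¹ * F (h n)⁻¹) atTop (𝓝 1) := by
    refine tendsto_mul_one_of_regularlyVarying hF0 hRV ht (fun x hx0 hx1 => ?_) fun x hx => ?_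
    · filter_upwards [hinf.eventually_gt_atTop 0, eventually_gt_atTop 0] with n hn hn0
      have hn' : (0 : ℝ) < n := Nat.cast_pos.2 hn0
      have hlt : h n < h n * x⁻¹ := lt_mul_of_one_lt_right hn ((one_lt_inv₀ hx0).2 hx1)
      nth_rewrite 1 [hh n] at hlt
      obtain ⟨w, ⟨hw0, hw⟩, hwlt⟩ := exists_lt_of_csInf_lt (hne n hn') hlt
      have hinv : (h n)⁻¹ * x ≤ w⁻¹ := by
        simpa [mul_inv, mul_comm] using inv_anti₀ hw0 hwlt.le
      have hmul := mul_le_mul hinv (hF hinv)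
        (hF0 _ (mul_pos (inv_pos.2 hn) hx0)).le (inv_nonneg.2 hw0.le)
      have := (le_div_iff₀' hn').1 (hmul.trans hw)
      rwa [← mul_assoc] at this
    · filter_upwards [hinf.eventually_gt_atTop 0, eventually_gt_atTop 0] with n hn hn0
      have hn' : (0 : ℝ) < n := Nat.cast_pos.2 hn0
      have hx0 : 0 < x := one_pos.trans hx
      have hlt : h n * x⁻¹ < h n := mul_lt_of_lt_one_right hn (inv_lt_one_of_one_lt₀ hx)
      nth_rewrite 2 [hh n] at hlt
      have hmem := notMem_of_lt_csInf hlt ⟨0, fun w hw => hw.1.le⟩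
      have hgt : 1 / (n : ℝ) < (h n)⁻¹ * x * F ((h n)⁻¹ * x) := by
        by_contra! hcon
        refine hmem ⟨by positivity, ?_⟩
        rw [mul_inv, inv_inv]
        exact hcon
      have := (div_lt_iff₀' hn').1 hgt
      rw [← mul_assoc] at this
      exact this.le
  have hratio := hF.tendsto_div_of_regularlyVarying hF_nonneg
    (sub_pos.2 hγ) hRV ht hθ hbθ
  have hmain : Tendsto (fun n : ℕ => (n : ℝ) * (h n)⁻¹ * F (b n)) atTop (𝓝 (θ ^ (γ₁ - 1))) := by
    rw [← one_mul (θ ^ (γ₁ - 1))]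
    refine (hcross.mul hratio).congr' ?_
    filter_upwards [hinf.eventually_gt_atTop 0] with n hn
    have := (hF0 _ (inv_pos.2 hn)).ne'
    rw [inv_mul_cancel_left₀ hn.ne', mul_assoc, mul_div_cancel₀ _ this]
  refine ⟨hmain, ?_⟩
  have hθγ : θ * θ ^ (γ₁ - 1) = θ ^ γ₁ := by
    rw [← Real.rpow_one_add' hθ (by linarith), add_sub_cancel]
  rw [← hθγ]
  refine (hbθ.mul hmain).congr' ?_
  filter_upwards [hinf.eventually_gt_atTop 0] with n hn
  field_simp
end

section
/- For every τ ∈ (0,1) and all real numbers u, v, the check function ρ_τ(y) := y(τ − 1(y ≤ 0)) satisfies the identity ρ_τ(u−v) − ρ_τ(u) = −v(τ − 1(u ≤ 0)) + ∫₀^v ( 1(u ≤ s) − 1(u ≤ 0) ) ds. -/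
open MeasureTheory Filter Set Topology
open scoped ENNReal Topology

/-- The check (quantile loss) function `ρ_τ(y) = y (τ - 1(y ≤ 0))`. -/
noncomputable def checkLoss (τ y : ℝ) : ℝ := y * (τ - if y ≤ 0 then 1 else 0)

theorem monotone_ite_le (u : ℝ) : Monotone fun s : ℝ => if u ≤ s then (1 : ℝ) else 0 := by
  intro a b hab
  dsimp only
  split_ifs <;> linarith

theorem hasDerivAt_max_sub_zero {u x : ℝ} (hx : x ≠ u) :
    HasDerivAt (fun s : ℝ => max (s - u) 0) (if u ≤ x then 1 else 0) x := by
  rcases lt_or_gt_of_ne hx with h | h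
  · rw [if_neg (not_le.mpr h)]
    refine (hasDerivAt_const x (0 : ℝ)).congr_of_eventuallyEq ?_
    filter_upwards [Iio_mem_nhds h] with s hs
    exact max_eq_right (sub_nonpos.mpr (le_of_lt hs))
  · rw [if_pos h.le]
    refine ((hasDerivAt_id x).sub_const u).congr_of_eventuallyEq ?_
    filter_upwards [Ioi_mem_nhds h] with s hs
    exact max_eq_left (sub_nonneg.mpr (le_of_lt hs))

theorem integral_ite_le (u a b : ℝ) :
    ∫ s in a..b, (if u ≤ s then (1 : ℝ) else 0) = max (b - u) 0 - max (a - u) 0 :=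
  integral_eq_of_hasDerivAt_off_countable (fun s : ℝ => max (s - u) 0) _
    (countable_singleton u) (by fun_prop) (fun _ hx => hasDerivAt_max_sub_zero hx.2)
    (monotone_ite_le u).intervalIntegrable

theorem checkLoss_eq_mul_add_max (τ y : ℝ) : checkLoss τ y = τ * y + max (-y) 0 := by
  unfold checkLoss
  split_ifs with h
  · rw [max_eq_left (by linarith)]; ring
  · rw [max_eq_right (by linarith)]; ring

/-- For every `τ ∈ (0,1)` and all real `u, v`, the check function satisfies
`ρ_τ(u-v) - ρ_τ(u) = -v (τ - 1(u ≤ 0)) + ∫₀^v ( 1(u ≤ s) - 1(u ≤ 0) ) ds`. -/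
theorem checkLoss_identity (τ : ℝ) (hτ : τ ∈ Set.Ioo (0:ℝ) 1) (u v : ℝ) :
    checkLoss τ (u - v) - checkLoss τ u
      = -v * (τ - if u ≤ 0 then 1 else 0)
        + ∫ s in (0:ℝ)..v, ((if u ≤ s then (1:ℝ) else 0) - if u ≤ 0 then 1 else 0) := by
  rw [intervalIntegral.integral_sub (monotone_ite_le u).intervalIntegrable
    intervalIntegrable_const, integral_ite_le, intervalIntegral.integral_const,
    checkLoss_eq_mul_add_max, checkLoss_eq_mul_add_max, neg_sub, zero_sub, smul_eq_mul]
  ring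
end
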